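/- Let S = {v₁,…,vₙ} be an (n,k)-uframe at which the minimum of F over all (n,k)-uframes is attained. Then any subset of pairwise collinear vectors of S has cardinality at most ⌊n/k⌋ + 1; that is, for any nonzero u ∈ ℝᵏ, the number of indices i with vᵢ parallel to u is at most ⌊n/k⌋ + 1. -/

import Mathlib

open MeasureTheory
open scoped RealInnerProductSpace ENNReal

/-- `S` is an `(n,k)`-uframe: `∑ᵢ vᵢ ⊗ vᵢ = I_k`. -/
def IsUframe {n k : ℕ} (v : Fin n → EuclideanSpace ℝ (Fin k)) : Prop :=
  ∀ x : EuclideanSpace ℝ (Fin k), ∑ i, ⟪v i, x⟫ • v i = x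

/-- `F(S)`: the volume of the convex hull of `{±v₁,…,±vₙ}` in `ℝᵏ`. -/
noncomputable def Fvol {n k : ℕ} (v : Fin n → EuclideanSpace ℝ (Fin k)) : ℝ≥0∞ :=
  volume (convexHull ℝ (Set.range v ∪ Set.range fun i => -v i))

section FrameMatrix

open scoped Matrix MatrixOrder

/-- The matrix of the frame operator `∑ᵢ vᵢ ⊗ vᵢ`. -/
noncomputable def frameMatrix {n k : ℕ} (v : Fin n → EuclideanSpace ℝ (Fin k)) :
    Matrix (Fin k) (Fin k) ℝ :=
  ∑ i, Matrix.vecMulVec (v i).ofLp (v i).ofLp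

lemma frameMatrix_mulVec {n k : ℕ} (v : Fin n → EuclideanSpace ℝ (Fin k))
    (x : EuclideanSpace ℝ (Fin k)) :
    frameMatrix v *ᵥ x.ofLp = (∑ i, ⟪v i, x⟫ • v i).ofLp := by
  simp only [frameMatrix, Matrix.sum_mulVec, Matrix.vecMulVec_mulVec, WithLp.ofLp_sum,
    WithLp.ofLp_smul, op_smul_eq_smul, EuclideanSpace.inner_eq_star_dotProduct, star_trivial,
    dotProduct_comm]

lemma isUframe_iff_frameMatrix_eq_one {n k : ℕ} (v : Fin n → EuclideanSpace ℝ (Fin k)) :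
    IsUframe v ↔ frameMatrix v = 1 := by
  constructor
  · intro h
    refine Matrix.ext_of_mulVec_single fun i => ?_
    have := frameMatrix_mulVec v (WithLp.toLp 2 (Pi.single i 1))
    rw [h] at this
    exact this.trans (Matrix.one_mulVec _).symm
  · intro h x
    have := frameMatrix_mulVec v x
    rw [h, Matrix.one_mulVec] at this
    exact (WithLp.ofLp_injective 2 this).symm

lemma posSemidef_frameMatrix {n k : ℕ} (v : Fin n → EuclideanSpace ℝ (Fin k)) :
    (frameMatrix v).PosSemidef :=
  Matrix.posSemidef_sum _ fun i _ => by
    simpa using Matrix.posSemidef_vecMulVec_self_star (v i).ofLp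

lemma frameMatrix_toLpLin {n k : ℕ} (v : Fin n → EuclideanSpace ℝ (Fin k))
    (B : Matrix (Fin k) (Fin k) ℝ) :
    frameMatrix (fun i => Matrix.toLpLin 2 2 B (v i)) = B * frameMatrix v * Bᵀ := by
  simp only [frameMatrix, Matrix.mul_sum, Matrix.sum_mul, Matrix.mul_vecMulVec,
    Matrix.vecMulVec_mul, Matrix.vecMul_transpose, Matrix.ofLp_toLpLin, Matrix.toLin'_apply]

lemma Fvol_toLpLin {n k : ℕ} (v : Fin n → EuclideanSpace ℝ (Fin k))
    (B : Matrix (Fin k) (Fin k) ℝ) :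
    Fvol (fun i => Matrix.toLpLin 2 2 B (v i)) = ENNReal.ofReal |B.det| * Fvol v := by
  have h : (Set.range (fun i => Matrix.toLpLin 2 2 B (v i)) ∪
      Set.range fun i => -Matrix.toLpLin 2 2 B (v i)) =
      Matrix.toLpLin 2 2 B '' (Set.range v ∪ Set.range fun i => -v i) := by
    simp only [Set.image_union, ← Set.range_comp, Function.comp_def, map_neg]
  rw [Fvol, h, ← LinearMap.image_convexHull, Measure.addHaar_image_linearMap,
    LinearMap.det_toLpLin, Fvol]

lemma Fvol_ne_top {n k : ℕ} (v : Fin n → EuclideanSpace ℝ (Fin k)) : Fvol v ≠ ∞ := by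
  refine (Bornology.IsBounded.measure_lt_top ?_).ne
  rw [isBounded_convexHull]
  exact ((Set.finite_range _).union (Set.finite_range _)).isBounded

lemma Fvol_pos {n k : ℕ} (hn : 0 < n) {v : Fin n → EuclideanSpace ℝ (Fin k)}
    (hv : IsUframe v) : 0 < Fvol v := by
  set s := Set.range v ∪ Set.range fun i => -v i
  have h0 : (0 : EuclideanSpace ℝ (Fin k)) ∈ affineSpan ℝ s := by
    refine convexHull_subset_affineSpan s ?_
    have h1 : v ⟨0, hn⟩ ∈ convexHull ℝ s := subset_convexHull ℝ s (Or.inl ⟨_, rfl⟩)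
    have h2 : -v ⟨0, hn⟩ ∈ convexHull ℝ s := subset_convexHull ℝ s (Or.inr ⟨⟨0, hn⟩, rfl⟩)
    simpa using (convex_convexHull ℝ s).midpoint_mem h1 h2
  have hspan : Submodule.span ℝ s = ⊤ := by
    refine eq_top_iff.2 fun x _ => ?_
    rw [← hv x]
    exact Submodule.sum_mem _ fun i _ =>
      Submodule.smul_mem _ _ (Submodule.subset_span (Or.inl ⟨i, rfl⟩))
  refine Measure.measure_pos_of_nonempty_interior _ ?_
  rw [interior_convexHull_nonempty_iff_affineSpan_eq_top, ← affineSpan_insert_eq_affineSpan ℝ h0]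
  exact SetLike.coe_injective (by rw [affineSpan_insert_zero, hspan]; rfl)

/-- A spanning system whose frame operator has determinant larger than `1` can be mapped to a
uframe by a volume-decreasing linear map. -/
lemma exists_isUframe_Fvol_lt {n k : ℕ} (w : Fin n → EuclideanSpace ℝ (Fin k))
    (hdet : 1 < (frameMatrix w).det) {V : ℝ≥0∞} (hV : 0 < V) (hwV : Fvol w ≤ V) :
    ∃ w' : Fin n → EuclideanSpace ℝ (Fin k), IsUframe w' ∧ Fvol w' < V := by
  obtain ⟨C, hC⟩ := CStarAlgebra.nonneg_iff_eq_star_mul_self.mp (posSemidef_frameMatrix w).nonneg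
  have hC' : frameMatrix w = Cᵀ * C := by
    rw [hC, Matrix.star_eq_conjTranspose, Matrix.conjTranspose_eq_transpose_of_trivial]
  rw [hC', Matrix.det_mul, Matrix.det_transpose] at hdet
  have hC1 : 1 < |C.det| := by
    rw [← one_lt_sq_iff_one_lt_abs]; nlinarith
  have hu : IsUnit C.det := isUnit_iff_ne_zero.2 (by rintro h; norm_num [h] at hdet)
  refine ⟨fun i => Matrix.toLpLin 2 2 (Cᵀ)⁻¹ (w i), ?_, ?_⟩
  · rw [isUframe_iff_frameMatrix_eq_one, frameMatrix_toLpLin, hC',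
      Matrix.nonsing_inv_mul_cancel_left _ _ (by simpa using hu), Matrix.transpose_nonsing_inv,
      Matrix.transpose_transpose, Matrix.mul_nonsing_inv _ hu]
  · rw [Fvol_toLpLin]
    have h1 : ENNReal.ofReal |(Cᵀ)⁻¹.det| < 1 := by
      rw [Matrix.det_nonsing_inv, Matrix.det_transpose, Ring.inverse_eq_inv', abs_inv,
        ← ENNReal.ofReal_one]
      exact (ENNReal.ofReal_lt_ofReal_iff one_pos).2 (inv_lt_one_of_one_lt₀ hC1)
    rcases eq_or_ne (Fvol w) 0 with h | h
    · simpa [h] using hV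
    · refine lt_of_lt_of_le ?_ hwV
      simpa using ENNReal.mul_lt_mul_left h (Fvol_ne_top w) h1

lemma frameMatrix_update {n k : ℕ} (v : Fin n → EuclideanSpace ℝ (Fin k)) (i : Fin n)
    (x : EuclideanSpace ℝ (Fin k)) :
    frameMatrix (Function.update v i x) = frameMatrix v -
      Matrix.vecMulVec (v i).ofLp (v i).ofLp + Matrix.vecMulVec x.ofLp x.ofLp := by
  simp only [frameMatrix]
  rw [← Finset.add_sum_erase _ _ (Finset.mem_univ i),
    ← Finset.add_sum_erase Finset.univ (fun i => Matrix.vecMulVec (v i).ofLp (v i).ofLp)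
      (Finset.mem_univ i),
    Finset.sum_congr rfl fun j hj => by rw [Function.update_of_ne (Finset.ne_of_mem_erase hj)],
    Function.update_self]
  abel

lemma det_one_sub_vecMulVec_add_vecMulVec {k : ℕ} (x y : EuclideanSpace ℝ (Fin k)) :
    (1 - Matrix.vecMulVec x.ofLp x.ofLp + Matrix.vecMulVec y.ofLp y.ofLp).det =
      (1 - ‖x‖ ^ 2) * (1 + ‖y‖ ^ 2) + ⟪x, y⟫ ^ 2 := by
  have h : 1 - Matrix.vecMulVec x.ofLp x.ofLp + Matrix.vecMulVec y.ofLp y.ofLp =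
      1 + (Matrix.of ![-x.ofLp, y.ofLp])ᵀ * Matrix.of ![x.ofLp, y.ofLp] := by
    ext a b
    simp [Matrix.mul_apply, Fin.sum_univ_two, Matrix.vecMulVec_apply]
    ring
  rw [h, Matrix.det_one_add_mul_comm, Matrix.det_fin_two]
  simp only [← real_inner_self_eq_norm_sq, EuclideanSpace.inner_eq_star_dotProduct]
  simp only [Matrix.add_apply, Matrix.mul_apply, Matrix.transpose_apply, Matrix.of_apply,
    Matrix.one_apply, dotProduct, star_trivial, Matrix.cons_val_zero, Matrix.cons_val_one,
    Pi.neg_apply, mul_neg, Finset.sum_neg_distrib, mul_comm]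
  norm_num
  ring

lemma Fvol_update_le {n k : ℕ} (v : Fin n → EuclideanSpace ℝ (Fin k)) (i j : Fin n) :
    Fvol (Function.update v i (v j)) ≤ Fvol v := by
  have h : ∀ l, Function.update v i (v j) l ∈ Set.range v := fun l => by
    rcases eq_or_ne l i with rfl | hl
    · simp
    · simp [Function.update_of_ne hl]
  refine measure_mono (convexHull_mono (Set.union_subset_union ?_ ?_))
  · rintro _ ⟨l, rfl⟩
    exact h l
  · rintro _ ⟨l, rfl⟩
    obtain ⟨m, hm⟩ := h l
    exact ⟨m, by simp only [hm]⟩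

/-- In a minimizer, replacing one vector by another does not increase the determinant of the
frame operator. -/
lemma minimizer_inequality {n k : ℕ} {v : Fin n → EuclideanSpace ℝ (Fin k)} (hv : IsUframe v)
    (hmin : ∀ v' : Fin n → EuclideanSpace ℝ (Fin k), IsUframe v' → Fvol v ≤ Fvol v')
    (i j : Fin n) :
    (1 - ‖v i‖ ^ 2) * (1 + ‖v j‖ ^ 2) + ⟪v i, v j⟫ ^ 2 ≤ 1 := by
  by_contra! h
  rw [← det_one_sub_vecMulVec_add_vecMulVec, ← (isUframe_iff_frameMatrix_eq_one v).1 hv,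
    ← frameMatrix_update] at h
  obtain ⟨w, hw, hlt⟩ := exists_isUframe_Fvol_lt _ h (Fvol_pos i.pos hv) (Fvol_update_le v i j)
  exact (hmin w hw).not_gt hlt

lemma IsUframe.sum_inner_sq {n k : ℕ} {v : Fin n → EuclideanSpace ℝ (Fin k)} (hv : IsUframe v)
    (x : EuclideanSpace ℝ (Fin k)) : ∑ i, ⟪v i, x⟫ ^ 2 = ‖x‖ ^ 2 := by
  calc ∑ i, ⟪v i, x⟫ ^ 2 = ⟪∑ i, ⟪v i, x⟫ • v i, x⟫ := by
        rw [sum_inner]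
        exact Finset.sum_congr rfl fun i _ => by rw [real_inner_smul_left, sq]
    _ = ‖x‖ ^ 2 := by rw [hv x, real_inner_self_eq_norm_sq]

lemma IsUframe.sum_norm_sq {n k : ℕ} {v : Fin n → EuclideanSpace ℝ (Fin k)} (hv : IsUframe v) :
    ∑ i, ‖v i‖ ^ 2 = k := by
  have h := congrArg Matrix.trace ((isUframe_iff_frameMatrix_eq_one v).1 hv)
  simp only [EuclideanSpace.real_norm_sq_eq]
  simpa [frameMatrix, Matrix.trace_sum, Matrix.trace_vecMulVec, dotProduct, sq] using h

end FrameMatrix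

/-- If the minimum of `F` over all `(n,k)`-uframes is attained at `S = {v₁,…,vₙ}`, then
for any nonzero `u ∈ ℝᵏ`, the number of indices `i` such that `vᵢ` is collinear with `u`
(i.e. a scalar multiple of `u`) is at most `⌊n/k⌋ + 1`. -/
theorem min_uframe_collinear_bound {n k : ℕ} (hk : 0 < k) (hkn : k ≤ n)
    (v : Fin n → EuclideanSpace ℝ (Fin k)) (hv : IsUframe v)
    (hmin : ∀ v' : Fin n → EuclideanSpace ℝ (Fin k), IsUframe v' → Fvol v ≤ Fvol v') :
    ∀ u : EuclideanSpace ℝ (Fin k), u ≠ 0 →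
      {i : Fin n | ∃ c : ℝ, v i = c • u}.ncard ≤ n / k + 1 := by
  classical
  intro u _
  set s := {i : Fin n | ∃ c : ℝ, v i = c • u}
  rcases s.eq_empty_or_nonempty with h | ⟨i, hi⟩
  · simp [h]
  set t := ‖v i‖ ^ 2 with ht
  have hinner : ∀ j ∈ s, ⟪v j, v i⟫ ^ 2 = ‖v j‖ ^ 2 * t := by
    rintro j ⟨c, hc⟩
    obtain ⟨d, hd⟩ := hi
    rw [ht, hc, hd, real_inner_smul_left, real_inner_smul_right, norm_smul, norm_smul,
      real_inner_self_eq_norm_sq, mul_pow, mul_pow, mul_pow, mul_pow, Real.norm_eq_abs,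
      Real.norm_eq_abs, sq_abs, sq_abs]
    ring
  have hnorm : ∀ j ∈ s, t ≤ ‖v j‖ ^ 2 := fun j hj => by
    have h1 := minimizer_inequality hv hmin j i
    rw [hinner j hj] at h1
    linarith
  have hle : (k : ℝ) ≤ (n + k - 1) * t := by
    have h1 : ∀ j, ‖v j‖ ^ 2 * (1 - t) ≤ (t - ⟪v j, v i⟫ ^ 2) := fun j => by
      have := minimizer_inequality hv hmin i j
      rw [real_inner_comm]
      linarith
    have h2 := Finset.sum_le_sum fun j (_ : j ∈ Finset.univ) => h1 j
    rw [← Finset.sum_mul, hv.sum_norm_sq, Finset.sum_sub_distrib, hv.sum_inner_sq] at h2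
    simp only [Finset.sum_const, Finset.card_univ, Fintype.card_fin, nsmul_eq_mul] at h2
    linarith
  have hk' : (0 : ℝ) < k := by exact_mod_cast hk
  have hn' : (1 : ℝ) ≤ n := by exact_mod_cast hk.trans_le hkn
  have htpos : 0 < t := by
    by_contra! h
    nlinarith
  have hcard : (s.ncard : ℝ) * t ≤ 1 := by
    have h1 : (s.ncard : ℝ) * (t * t) ≤ t := by
      rw [Set.ncard_eq_toFinset_card', ← nsmul_eq_mul]
      calc s.toFinset.card • (t * t) ≤ ∑ j ∈ s.toFinset, ⟪v j, v i⟫ ^ 2 :=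
            Finset.card_nsmul_le_sum _ _ _ fun j hj => by
              rw [Set.mem_toFinset] at hj
              rw [hinner j hj]
              exact mul_le_mul_of_nonneg_right (hnorm j hj) htpos.le
        _ ≤ ∑ j, ⟪v j, v i⟫ ^ 2 :=
            Finset.sum_le_sum_of_subset_of_nonneg (Finset.subset_univ _) fun _ _ _ => sq_nonneg _
        _ = t := hv.sum_inner_sq _
    nlinarith
  have hfin : (s.ncard : ℝ) * k ≤ n + k := by
    nlinarith [mul_le_mul_of_nonneg_left hle (Nat.cast_nonneg (α := ℝ) s.ncard)]
  have hfin' : s.ncard * k ≤ n + k := by exact_mod_cast hfin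
  rw [← Nat.add_div_right n hk]
  exact (Nat.le_div_iff_mul_le hk).2 hfin'
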